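/- Let G be a (banner, odd hole)-free graph. Then at least one of the following holds: (i) G is perfect; (ii) the stability number of G is at most 2; (iii) every odd antihole A of G is contained in a homogeneous set H of G such that the subgraph induced by H is co-triangle-free. -/

import Mathlib

open SimpleGraph

/-- The banner: a chordless 4-cycle 0-1-2-3-0 together with a fifth vertex 4
adjacent to exactly one vertex (vertex 0) of the cycle. -/
def banner : SimpleGraph (Fin 5) :=
  SimpleGraph.fromRel (fun i j =>
    (i = 0 ∧ j = 1) ∨ (i = 1 ∧ j = 2) ∨ (i = 2 ∧ j = 3) ∨ (i = 3 ∧ j = 0) ∨ (i = 0 ∧ j = 4))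

/-- A graph is banner-free if it has no induced subgraph isomorphic to the banner. -/
def BannerFree {V : Type*} (G : SimpleGraph V) : Prop := ¬ Nonempty (banner ↪g G)

/-- A graph is C5-free if it has no induced subgraph isomorphic to the chordless 5-cycle. -/
def C5Free {V : Type*} (G : SimpleGraph V) : Prop :=
  ¬ Nonempty (SimpleGraph.cycleGraph 5 ↪g G)

/-- A graph is odd-hole-free if it has no induced chordless cycle of odd length `n ≥ 5`
(odd holes are the odd chordless cycles with at least four, hence at least five, vertices). -/
def OddHoleFree {V : Type*} (G : SimpleGraph V) : Prop :=
  ∀ n : ℕ, 5 ≤ n → Odd n → ¬ Nonempty (SimpleGraph.cycleGraph n ↪g G)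

/-- `A` is an odd antihole of `G`: the subgraph induced by `A` is isomorphic to the
complement of a chordless cycle on an odd number `n ≥ 5` of vertices. -/
def IsOddAntihole {V : Type*} (G : SimpleGraph V) (A : Set V) : Prop :=
  ∃ n : ℕ, 5 ≤ n ∧ Odd n ∧ Nonempty ((SimpleGraph.cycleGraph n)ᶜ ≃g G.induce A)

/-- `H` is a homogeneous set of `G`: `2 ≤ |H| < |V(G)|` and every vertex outside `H`
is adjacent to all vertices of `H` or to none of them. -/
def IsHomogeneous {V : Type*} (G : SimpleGraph V) (H : Set V) : Prop :=
  2 ≤ H.ncard ∧ H ≠ Set.univ ∧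
    ∀ v ∉ H, (∀ h ∈ H, G.Adj v h) ∨ (∀ h ∈ H, ¬ G.Adj v h)

/-- A graph is perfect if every induced subgraph has chromatic number equal to
its clique number. -/
def IsPerfect {V : Type*} (G : SimpleGraph V) : Prop :=
  ∀ S : Set V, (G.induce S).chromaticNumber = ((G.induce S).cliqueNum : ℕ∞)

/-- A graph is perfectly divisible if every induced subgraph `G[S]` contains a set `X`
of vertices meeting all largest cliques of `G[S]` and inducing a perfect graph. -/
def PerfectlyDivisible {V : Type*} (G : SimpleGraph V) : Prop :=
  ∀ S : Set V, ∃ X ⊆ S, IsPerfect (G.induce X) ∧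
    ∀ t : Finset V, ↑t ⊆ S → G.IsNClique ((G.induce S).cliqueNum) t → ∃ x ∈ X, x ∈ t

/-- A graph is `k`-divisible if the vertex set of each of its induced subgraphs `G[S]`
having at least one edge can be partitioned into `k` sets, none of which contains a
clique of size `ω(G[S])`.  (A graph with no edges is trivially `k`-divisible.) -/
def KDivisible {V : Type*} (G : SimpleGraph V) (k : ℕ) : Prop :=
  ∀ S : Set V, (∃ a ∈ S, ∃ b ∈ S, G.Adj a b) →
    ∃ P : Fin k → Set V, (∀ v ∈ S, ∃! i, v ∈ P i) ∧
      ∀ i, P i ⊆ S ∧ ¬ ∃ t : Finset V, ↑t ⊆ P i ∧ G.IsNClique ((G.induce S).cliqueNum) t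

/-- The maximum total weight `α_w(G)` of a stable (independent) set of the weighted
graph `G`; stable sets of `G` are exactly the cliques of the complement of `G`. -/
noncomputable def alphaW {V : Type*} (G : SimpleGraph V) (w : V → ℤ) : ℤ :=
  sSup {x : ℤ | ∃ s : Finset V, Gᶜ.IsClique (↑s : Set V) ∧ x = ∑ v ∈ s, w v}

/-- `C` is a clique cutset of the connected graph `G` if `C` is a clique and
deleting `C` from `G` leaves a disconnected graph. -/
def IsCliqueCutset {V : Type*} (G : SimpleGraph V) (C : Set V) : Prop :=
  G.Connected ∧ G.IsClique C ∧ ¬ (G.induce Cᶜ).Preconnected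

/-- No induced complement of a banner: a triangle `x y z` with a path `z - p - q` attached. -/
def CoBannerFree {V : Type*} (F : SimpleGraph V) : Prop :=
  ∀ x y z p q : V, F.Adj x y → F.Adj y z → F.Adj x z → F.Adj z p → F.Adj p q →
    ¬ F.Adj x p → ¬ F.Adj y p → ¬ F.Adj x q → ¬ F.Adj y q → ¬ F.Adj z q → False

/-- No induced chordless 5-cycle, stated on explicit vertices. -/
def PentagonFree {V : Type*} (F : SimpleGraph V) : Prop :=
  ∀ x y z p q : V, F.Adj x y → F.Adj y z → F.Adj z p → F.Adj p q → F.Adj q x →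
    ¬ F.Adj x z → ¬ F.Adj x p → ¬ F.Adj y p → ¬ F.Adj y q → ¬ F.Adj z q → False

/-- `c` lists periodically the vertices of a chordless cycle of odd length `n ≥ 7`. -/
structure IsOddHoleWalk {V : Type*} (F : SimpleGraph V) (n : ℕ) (c : ℤ → V) : Prop where
  odd : Odd n
  periodic : Function.Periodic c (n : ℤ)
  adj : ∀ i, F.Adj (c i) (c (i + 1))
  seven_le : 7 ≤ n
  not_adj_of_le : ∀ i j : ℤ, 2 ≤ j - i → j - i ≤ n - 2 → ¬ F.Adj (c i) (c j)

/-- The vertices having a non-neighbour on the cycle. -/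
def notComplete {V : Type*} (F : SimpleGraph V) (c : ℤ → V) : Set V :=
  {v | ∃ i, ¬ F.Adj v (c i)}

/-- The vertices of `W` reachable from `C` inside `W` in at most `k` steps, together with `C`. -/
def reach {V : Type*} (F : SimpleGraph V) (W C : Set V) : ℕ → Set V
  | 0 => C
  | k + 1 => reach F W C k ∪ {v | v ∈ W ∧ ∃ q ∈ reach F W C k, F.Adj v q}

section
variable {V : Type*} {F : SimpleGraph V} {n : ℕ} {c : ℤ → V}

namespace IsOddHoleWalk

theorem not_adj (hc : IsOddHoleWalk F n c) (i j : ℤ) (h2 : 2 ≤ j - i) (h5 : j - i ≤ 5) :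
    ¬ F.Adj (c i) (c j) :=
  hc.not_adj_of_le i j h2 (by have := hc.seven_le; omega)

theorem forall_of_step_two (hc : IsOddHoleWalk F n c) {P : ℤ → Prop}
    (hP : Function.Periodic P (n : ℤ)) {i : ℤ} (hi : P i)
    (step : ∀ j, P j → P (j + 2)) (j : ℤ) : P j := by
  have hm : ∀ m : ℕ, P (i + 2 * m) := by
    intro m
    induction m with
    | zero => simpa using hi
    | succ m ih =>
      have := step _ ih
      rwa [show i + 2 * (m : ℤ) + 2 = i + 2 * ((m + 1 : ℕ) : ℤ) by push_cast; ring] at this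
  obtain ⟨k, hk⟩ := hc.odd
  have hn : (n : ℤ) = 2 * k + 1 := by exact_mod_cast hk
  have hnn : 0 ≤ (j - i) * (k + 1) + |j - i| * n := by
    have h1 : -|j - i| ≤ j - i := neg_abs_le _
    have h2 : (0 : ℤ) ≤ |j - i| := abs_nonneg _
    rw [hn]
    nlinarith [mul_nonneg h2 (Int.natCast_nonneg k),
      mul_le_mul_of_nonneg_right h1 (by positivity : (0 : ℤ) ≤ k + 1)]
  have h := hm ((j - i) * (k + 1) + |j - i| * n).toNat
  rw [Int.toNat_of_nonneg hnn] at h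
  have e : i + 2 * ((j - i) * (k + 1) + |j - i| * n) = j + (j - i + 2 * |j - i|) * n := by
    rw [hn]; ring
  rwa [e, ← Int.cast_id (n := j - i + 2 * |j - i|), hP.int_mul _ j] at h

theorem forall_adj (hc : IsOddHoleWalk F n c) {v : V} {i : ℤ} (hi : F.Adj v (c i))
    (step : ∀ j, F.Adj v (c j) → F.Adj v (c (j + 2))) (j : ℤ) : F.Adj v (c j) :=
  hc.forall_of_step_two (P := fun j => F.Adj v (c j)) (fun j => by simp only [hc.periodic j])
    hi step j

theorem mem_notComplete (_hc : IsOddHoleWalk F n c) (i : ℤ) : c i ∈ notComplete F c :=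
  ⟨i, F.loopless.irrefl _⟩

theorem adj_of_pair (hc : IsOddHoleWalk F n c) (hF : CoBannerFree F) {v : V} {i : ℤ}
    (h0 : F.Adj v (c i)) (h1 : F.Adj v (c (i + 1))) : F.Adj v (c (i + 2)) := by
  have key : ∀ i, F.Adj v (c i) → F.Adj v (c (i + 1)) → ¬ F.Adj v (c (i + 2)) →
      F.Adj v (c (i + 3)) ∧ F.Adj v (c (i + 4)) := by
    intro i h0 h1 h2
    have e1 := hc.adj i
    have e2 := hc.adj (i + 1)
    have e3 := hc.adj (i + 2)
    have e4 := hc.adj (i + 3)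
    rw [add_assoc] at e2 e3 e4
    norm_num at e2 e3 e4
    have h3 : F.Adj v (c (i + 3)) := by
      by_contra h3
      exact hF _ _ _ _ _ h0 e1 h1 e2 e3 h2 (hc.not_adj _ _ (by omega) (by omega)) h3
        (hc.not_adj _ _ (by omega) (by omega)) (hc.not_adj _ _ (by omega) (by omega))
    refine ⟨h3, ?_⟩
    by_contra h4
    exact hF _ _ _ _ _ e1 h1.symm h0.symm h3 e4 (hc.not_adj _ _ (by omega) (by omega))
      (hc.not_adj _ _ (by omega) (by omega)) (hc.not_adj _ _ (by omega) (by omega))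
      (hc.not_adj _ _ (by omega) (by omega)) h4
  by_contra h2
  obtain ⟨h3, h4⟩ := key i h0 h1 h2
  have e2 := hc.adj (i + 1)
  have e3 := hc.adj (i + 2)
  have e5 := hc.adj (i + 4)
  have e7 := hc.adj (i + 6)
  rw [add_assoc] at e2 e3 e5 e7
  norm_num at e2 e3 e5 e7
  by_cases h5 : F.Adj v (c (i + 5))
  · exact hF _ _ _ _ _ e5 h5.symm h4.symm h1 e2
      (fun h => hc.not_adj _ _ (by omega) (by omega) h.symm)
      (fun h => hc.not_adj _ _ (by omega) (by omega) h.symm)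
      (fun h => hc.not_adj _ _ (by omega) (by omega) h.symm)
      (fun h => hc.not_adj _ _ (by omega) (by omega) h.symm) h2
  · obtain ⟨h6, h7⟩ := key (i + 3) h3 (by rwa [add_assoc]) (by rwa [add_assoc])
    rw [add_assoc] at h6 h7
    norm_num at h6 h7
    exact hF _ _ _ _ _ e7 h7.symm h6.symm h3 e3.symm
      (fun h => hc.not_adj _ _ (by omega) (by omega) h.symm)
      (fun h => hc.not_adj _ _ (by omega) (by omega) h.symm)
      (fun h => hc.not_adj _ _ (by omega) (by omega) h.symm)
      (fun h => hc.not_adj _ _ (by omega) (by omega) h.symm) h2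

theorem not_adj_succ (hc : IsOddHoleWalk F n c) (hF : CoBannerFree F) {v : V}
    (hv : v ∈ notComplete F c) {i : ℤ} (h0 : F.Adj v (c i)) : ¬ F.Adj v (c (i + 1)) := by
  intro h1
  obtain ⟨j, hj⟩ := hv
  refine hj (hc.forall_of_step_two (P := fun j => F.Adj v (c j) ∧ F.Adj v (c (j + 1)))
    (fun j => ?_) ⟨h0, h1⟩ ?_ j).1
  · simp only [hc.periodic j, add_right_comm j (n : ℤ) 1, hc.periodic (j + 1)]
  · rintro j ⟨a0, a1⟩
    have a2 := hc.adj_of_pair hF a0 a1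
    have a3 : F.Adj v (c (j + 1 + 2)) :=
      hc.adj_of_pair hF a1 (by rwa [add_assoc])
    exact ⟨a2, by rwa [add_right_comm]⟩

theorem exists_not_adj_pair (hc : IsOddHoleWalk F n c) (hF : CoBannerFree F) {v : V}
    (hv : v ∈ notComplete F c) : ∃ i, ¬ F.Adj v (c i) ∧ ¬ F.Adj v (c (i + 1)) := by
  by_contra! h
  obtain ⟨i, hi⟩ := hv
  refine hi (hc.forall_adj (h i hi) (fun j hj => ?_) i)
  have := h (j + 1) (hc.not_adj_succ hF ⟨i, hi⟩ hj)
  rwa [add_assoc] at this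

theorem not_triangle (hc : IsOddHoleWalk F n c) (hF : CoBannerFree F) (hP : PentagonFree F)
    {x y : V} (hx : x ∈ notComplete F c) (hy : y ∈ notComplete F c) (hxy : F.Adj x y) {i : ℤ}
    (hxi : F.Adj x (c i)) : ¬ F.Adj y (c i) := by
  have key : ∀ {x y : V}, x ∈ notComplete F c → y ∈ notComplete F c → F.Adj x y → ∀ i : ℤ,
      F.Adj x (c i) → F.Adj y (c i) → F.Adj x (c (i + 2)) → F.Adj y (c (i + 2)) := by
    intro x y hx hy hxy i hxi hyi hx2
    have e1 := hc.adj i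
    have e2 := hc.adj (i + 1)
    have e3 := hc.adj (i + 2)
    have hx3 := hc.not_adj_succ hF hx hx2
    have hy1 := hc.not_adj_succ hF hy hyi
    rw [add_assoc] at e2 e3 hx3
    norm_num at e2 e3 hx3
    by_contra hy2
    by_cases hy3 : F.Adj y (c (i + 3))
    · exact hP _ _ _ _ _ e1 e2 e3 hy3.symm hyi (hc.not_adj _ _ (by omega) (by omega))
        (hc.not_adj _ _ (by omega) (by omega)) (hc.not_adj _ _ (by omega) (by omega))
        (fun h => hy1 h.symm) (fun h => hy2 h.symm)
    · exact hF _ _ _ _ _ hyi hxi.symm hxy.symm hx2 e3 hy2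
        (hc.not_adj _ _ (by omega) (by omega)) hy3 (hc.not_adj _ _ (by omega) (by omega)) hx3
  intro hyi
  obtain ⟨k, hk⟩ := hx
  have hx : x ∈ notComplete F c := ⟨k, hk⟩
  refine hk (hc.forall_of_step_two (P := fun j => F.Adj x (c j) ∧ F.Adj y (c j))
    (fun j => by simp only [hc.periodic j]) ⟨hxi, hyi⟩ ?_ k).1
  rintro j ⟨hxj, hyj⟩
  have hor : F.Adj x (c (j + 2)) ∨ F.Adj y (c (j + 2)) := by
    by_contra! h
    have e2 := hc.adj (j + 1)
    rw [add_assoc] at e2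
    exact hF _ _ _ _ _ hxy hyj hxj (hc.adj j) e2 (hc.not_adj_succ hF hx hxj)
      (hc.not_adj_succ hF hy hyj) h.1 h.2 (hc.not_adj _ _ (by omega) (by omega))
  rcases hor with h | h
  · exact ⟨h, key hx hy hxy j hxj hyj h⟩
  · exact ⟨key hy hx hxy.symm j hyj hxj h, h⟩

theorem not_adj_of_triangle (hc : IsOddHoleWalk F n c) (hF : CoBannerFree F)
    (hP : PentagonFree F) {t x y : V} (ht : t ∈ notComplete F c) (hx : x ∈ notComplete F c)
    (hy : y ∈ notComplete F c) (htx : F.Adj t x) (hxy : F.Adj x y) (hty : F.Adj t y) (i : ℤ) :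
    ¬ F.Adj t (c i) := by
  have next : ∀ {t x y : V}, t ∈ notComplete F c → x ∈ notComplete F c → y ∈ notComplete F c →
      F.Adj t x → F.Adj x y → F.Adj t y → ∀ i, F.Adj t (c i) →
      F.Adj x (c (i + 1)) ∨ F.Adj y (c (i + 1)) := by
    intro t x y ht hx hy htx hxy hty i hi
    by_contra! h
    exact hF _ _ _ _ _ hxy hty.symm htx.symm hi (hc.adj i)
      (hc.not_triangle hF hP ht hx htx hi) (hc.not_triangle hF hP ht hy hty hi) h.1 h.2
      (hc.not_adj_succ hF ht hi)
  have two : ∀ {t x y : V}, t ∈ notComplete F c → x ∈ notComplete F c → y ∈ notComplete F c →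
      F.Adj t x → F.Adj x y → F.Adj t y → ∀ i, F.Adj t (c i) → F.Adj x (c (i + 1)) →
      F.Adj t (c (i + 2)) := by
    intro t x y ht hx hy htx hxy hty i hi hi1
    have e2 := hc.adj (i + 1)
    rw [add_assoc] at e2
    have h := next hx ht hy htx.symm hty hxy (i + 1) hi1
    rw [add_assoc] at h
    refine h.resolve_right fun hy2 => ?_
    exact hP _ _ _ _ _ hi (hc.adj i) e2 hy2.symm hty.symm (hc.not_adj_succ hF ht hi)
      (hc.not_triangle hF hP hy ht hty.symm hy2) (hc.not_adj _ _ (by omega) (by omega))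
      (fun h => hc.not_triangle hF hP ht hy hty hi h.symm)
      (fun h => hc.not_triangle hF hP hx hy hxy hi1 h.symm)
  intro hi
  obtain ⟨k, hk⟩ := ht
  have ht : t ∈ notComplete F c := ⟨k, hk⟩
  refine hk (hc.forall_adj hi (fun j hj => ?_) k)
  rcases next ht hx hy htx hxy hty j hj with h | h
  · exact two ht hx hy htx hxy hty j hj h
  · exact two ht hy hx hty hxy.symm htx j hj h

theorem reach_subset (hc : IsOddHoleWalk F n c) (k : ℕ) :
    reach F (notComplete F c) (Set.range c) k ⊆ notComplete F c := by
  induction k with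
  | zero => rintro _ ⟨i, rfl⟩; exact hc.mem_notComplete i
  | succ k ih => exact Set.union_subset ih fun v hv => hv.1

theorem not_triangle_of_mem_reach (hc : IsOddHoleWalk F n c) (hF : CoBannerFree F)
    (hP : PentagonFree F) (k : ℕ) : ∀ t ∈ reach F (notComplete F c) (Set.range c) k,
    ∀ x ∈ notComplete F c, ∀ y ∈ notComplete F c, F.Adj t x → F.Adj x y → ¬ F.Adj t y := by
  induction k with
  | zero =>
    rintro _ ⟨i, rfl⟩ x hx y hy htx hxy hty
    exact hc.not_triangle hF hP hx hy hxy htx.symm hty.symm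
  | succ k ih =>
    rintro t (ht | ⟨htW, q, hq, htq⟩) x hx y hy htx hxy hty
    · exact ih t ht x hx y hy htx hxy hty
    cases k with
    | zero =>
      obtain ⟨i, rfl⟩ := hq
      exact hc.not_adj_of_triangle hF hP htW hx hy htx hxy hty i htq
    | succ k =>
      have hqW := hc.reach_subset _ hq
      by_cases htk : t ∈ reach F (notComplete F c) (Set.range c) (k + 1)
      · exact ih t htk x hx y hy htx hxy hty
      rcases id hq with hq' | ⟨-, r, hr, hqr⟩
      · exact htk (Or.inr ⟨htW, q, hq', htq⟩)
      have far : ∀ w ∈ notComplete F c, w ∉ reach F (notComplete F c) (Set.range c) (k + 1) →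
          ¬ F.Adj w r := fun w hw hwk h => hwk (Or.inr ⟨hw, r, hr, h⟩)
      exact hF _ _ _ _ _ hxy hty.symm htx.symm htq hqr
        (fun h => ih q hq t htW x hx htq.symm htx h.symm)
        (fun h => ih q hq t htW y hy htq.symm hty h.symm)
        (far x hx fun h => ih x h t htW y hy htx.symm hty hxy)
        (far y hy fun h => ih y h t htW x hx hty.symm htx hxy.symm) (far t htW htk)

theorem adj_of_complete_of_adj (hc : IsOddHoleWalk F n c) (hF : CoBannerFree F) {u v : V}
    (hu : u ∉ notComplete F c) (hv : v ∈ notComplete F c) {i : ℤ} (hi : F.Adj v (c i)) :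
    F.Adj u v := by
  have hu' : ∀ i, F.Adj u (c i) := by simpa [notComplete] using hu
  by_contra huv
  have hb : ∀ j k, ¬ F.Adj v (c j) → ¬ F.Adj v (c (j + 1)) → F.Adj v (c k) →
      ¬ F.Adj (c j) (c k) → ¬ F.Adj (c (j + 1)) (c k) → False := fun j k h0 h1 hk n0 n1 =>
    hF _ _ _ _ _ (hc.adj j) (hu' (j + 1)).symm (hu' j).symm (hu' k) hk.symm n0 n1
      (fun h => h0 h.symm) (fun h => h1 h.symm) huv
  obtain ⟨j, h0, h1⟩ := hc.exists_not_adj_pair hF hv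
  have hn := hc.seven_le
  have mid : ∀ m, j + 3 ≤ m → m ≤ j + n - 2 → ¬ F.Adj v (c m) := fun m hm hm' h =>
    hb j m h0 h1 h (hc.not_adj_of_le _ _ (by omega) (by omega))
      (hc.not_adj_of_le _ _ (by omega) (by omega))
  have last : ¬ F.Adj v (c (j + n - 1)) := fun h =>
    hb (j + 3) (j + n - 1) (mid _ (by omega) (by omega)) (mid _ (by omega) (by omega)) h
      (hc.not_adj_of_le _ _ (by omega) (by omega)) (hc.not_adj_of_le _ _ (by omega) (by omega))
  have first : ¬ F.Adj v (c (j + 2)) := fun h =>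
    hb (j + n - 2) (j + 2) (mid _ (by omega) (by omega))
      (by rwa [show j + (n : ℤ) - 2 + 1 = j + n - 1 by ring]) h
      (fun h => hc.not_adj_of_le _ _ (by omega) (by omega) h.symm)
      (fun h => hc.not_adj_of_le _ _ (by omega) (by omega) h.symm)
  obtain ⟨k, hk0, hkn, hk⟩ : ∃ k, j ≤ k ∧ k < j + n ∧ F.Adj v (c k) := by
    refine ⟨j + (i - j) % n, ?_, ?_, ?_⟩
    · have := Int.emod_nonneg (i - j) (by omega : (n : ℤ) ≠ 0)
      omega
    · have := Int.emod_lt_of_pos (i - j) (by omega : (0 : ℤ) < n)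
      omega
    · rw [← hc.periodic.int_mul ((i - j) / n), Int.cast_id]
      have := Int.emod_add_mul_ediv (i - j) n
      rwa [show j + (i - j) % n + (i - j) / n * n = i by linarith]
  rcases (by omega : k = j ∨ k = j + 1 ∨ k = j + 2 ∨ k = j + n - 1 ∨
    (j + 3 ≤ k ∧ k ≤ j + n - 2)) with rfl | rfl | rfl | rfl | ⟨ha, hb⟩
  exacts [h0 hk, h1 hk, first hk, last hk, mid k ha hb hk]

theorem adj_of_complete (hc : IsOddHoleWalk F n c) (hF : CoBannerFree F) {u : V}
    (hu : u ∉ notComplete F c) (k : ℕ) :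
    ∀ v ∈ reach F (notComplete F c) (Set.range c) k, F.Adj u v := by
  have hu' : ∀ i, F.Adj u (c i) := by simpa [notComplete] using hu
  induction k with
  | zero => rintro _ ⟨i, rfl⟩; exact hu' i
  | succ k ih =>
    rintro v (hv | ⟨hvW, q, hq, hvq⟩)
    · exact ih v hv
    by_cases hvc : ∃ i, F.Adj v (c i)
    · exact hc.adj_of_complete_of_adj hF hu hvW hvc.choose_spec
    push Not at hvc
    by_contra huv
    obtain ⟨j, h0, h1⟩ := hc.exists_not_adj_pair hF (hc.reach_subset _ hq)
    exact hF _ _ _ _ _ (hc.adj j) (hu' _).symm (hu' _).symm (ih q hq) hvq.symm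
      (fun h => h0 h.symm) (fun h => h1 h.symm) (fun h => hvc _ h.symm)
      (fun h => hvc _ h.symm) huv

/-- A chordless odd cycle of length at least 7 lies in a triangle-free module. -/
theorem exists_module (hc : IsOddHoleWalk F n c) (hF : CoBannerFree F) (hP : PentagonFree F) :
    ∃ H : Set V, Set.range c ⊆ H ∧
      (∀ v ∉ H, (∀ h ∈ H, F.Adj v h) ∨ ∀ h ∈ H, ¬ F.Adj v h) ∧
      ∀ x ∈ H, ∀ y ∈ H, ∀ z ∈ H, F.Adj x y → F.Adj y z → ¬ F.Adj x z := by
  refine ⟨⋃ k, reach F (notComplete F c) (Set.range c) k,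
    Set.subset_iUnion (reach F (notComplete F c) (Set.range c)) 0, fun v hv => ?_,
    fun x hx y hy z hz => ?_⟩
  · simp only [Set.mem_iUnion, not_exists] at hv ⊢
    by_cases hvW : v ∈ notComplete F c
    · exact Or.inr fun h ⟨k, hk⟩ ha => hv (k + 1) (Or.inr ⟨hvW, h, hk, ha⟩)
    · exact Or.inl fun h ⟨k, hk⟩ => hc.adj_of_complete hF hvW k h hk
  · simp only [Set.mem_iUnion] at hx hy hz
    obtain ⟨k, hx⟩ := hx
    obtain ⟨l, hy⟩ := hy
    obtain ⟨m, hz⟩ := hz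
    exact hc.not_triangle_of_mem_reach hF hP k x hx y (hc.reach_subset l hy) z
      (hc.reach_subset m hz)

end IsOddHoleWalk
end

theorem BannerFree.coBannerFree_compl {V : Type*} {G : SimpleGraph V} (hG : BannerFree G) :
    CoBannerFree Gᶜ := by
  intro x y z p q hxy hyz hxz hzp hpq hxp hyp hxq hyq hzq
  have n1 : x ≠ p := by rintro rfl; exact hyp hxy.symm
  have n2 : y ≠ p := by rintro rfl; exact hxp hxy
  have n3 : x ≠ q := by rintro rfl; exact hyq hxy.symm
  have n4 : y ≠ q := by rintro rfl; exact hxq hxy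
  have n5 : z ≠ q := by rintro rfl; exact hxq hxz
  simp only [compl_adj, not_and, not_not] at *
  have := n1.symm; have := n2.symm; have := n3.symm; have := n4.symm; have := n5.symm
  have inj : Function.Injective ![q, x, p, y, z] := by
    intro i j
    fin_cases i <;> fin_cases j <;> simp_all [eq_comm]
  refine hG ⟨⟨⟨_, inj⟩, fun {i j} => ?_⟩⟩
  simp only [Function.Embedding.coeFn_mk]
  clear inj
  fin_cases i <;> fin_cases j <;> simp_all [banner, G.adj_comm]

theorem pentagonFree_compl {V : Type*} {G : SimpleGraph V} (hG : C5Free G) :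
    PentagonFree Gᶜ := by
  intro x y z p q hxy hyz hzp hpq hqx hxz hxp hyp hyq hzq
  have n1 : x ≠ z := by rintro rfl; exact hxp hzp
  have n2 : x ≠ p := by rintro rfl; exact hxz hzp.symm
  have n3 : y ≠ p := by rintro rfl; exact hyq hpq
  have n4 : y ≠ q := by rintro rfl; exact hyp hpq.symm
  have n5 : z ≠ q := by rintro rfl; exact hxz hqx.symm
  simp only [compl_adj, not_and, not_not] at *
  have := n1.symm; have := n2.symm; have := n3.symm; have := n4.symm; have := n5.symm
  have inj : Function.Injective ![x, z, q, y, p] := by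
    intro i j
    fin_cases i <;> fin_cases j <;> simp_all [eq_comm]
  refine hG ⟨⟨⟨_, inj⟩, fun {i j} => ?_⟩⟩
  simp only [Function.Embedding.coeFn_mk]
  clear inj
  fin_cases i <;> fin_cases j <;> simp_all [cycleGraph_adj, G.adj_comm] <;> decide

/-- The chordless 5-cycle is self-complementary. -/
def pentagonEmbeddingCompl : cycleGraph 5 ↪g (cycleGraph 5)ᶜ where
  toFun i := 2 * i
  inj' i j := by revert i j; decide
  map_rel_iff' {i j} := by
    simp only [compl_adj, cycleGraph_adj]
    revert i j
    decide

/-- The residue of an integer, as an element of `Fin n`. -/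
def residue (n : ℕ) [NeZero n] (i : ℤ) : Fin n :=
  ⟨(i % n).toNat, by
    have h := Int.emod_lt_of_pos i (by exact_mod_cast NeZero.pos n : (0 : ℤ) < n)
    have := NeZero.pos n
    omega⟩

theorem residue_val {n : ℕ} [NeZero n] (i : ℤ) : ((residue n i : ℕ) : ℤ) = i % n :=
  Int.toNat_of_nonneg (Int.emod_nonneg _ (by exact_mod_cast NeZero.ne n))

theorem residue_sub_val {n : ℕ} [NeZero n] (i j : ℤ) :
    (((residue n i - residue n j : Fin n) : ℕ) : ℤ) = (i - j) % n := by
  rw [Fin.val_sub, Int.natCast_emod, Nat.cast_add, Nat.cast_sub (residue n j).is_lt.le,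
    residue_val, residue_val]
  rw [Int.emod_eq_emod_iff_emod_sub_eq_zero, ← Int.dvd_iff_emod_eq_zero]
  have hi := Int.emod_add_mul_ediv i n
  have hj := Int.emod_add_mul_ediv j n
  exact ⟨1 + j / n - i / n, by linear_combination hi - hj⟩

theorem residue_of_lt {n : ℕ} [NeZero n] (k : Fin n) : residue n (k : ℕ) = k := by
  ext
  have := residue_val (n := n) (k : ℕ)
  rw [Int.emod_eq_of_lt (by omega) (by omega)] at this
  exact_mod_cast this

/-- The vertices of an odd antihole form an odd hole of the complement. -/
theorem isOddHoleWalk_compl {V : Type*} {G : SimpleGraph V} {A : Set V} {n : ℕ} [NeZero n]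
    (h7 : 5 < n) (hn : Odd n) (e : (cycleGraph n)ᶜ ≃g G.induce A) :
    IsOddHoleWalk Gᶜ n fun i => (e (residue n i) : V) := by
  have hadj : ∀ i j : ℤ, Gᶜ.Adj (e (residue n i) : V) (e (residue n j)) ↔
      (i - j) % n = 1 ∨ (j - i) % n = 1 := by
    intro i j
    have h : G.Adj (e (residue n i) : V) (e (residue n j)) ↔
        (cycleGraph n)ᶜ.Adj (residue n i) (residue n j) := e.map_adj_iff
    rw [compl_adj, h, compl_adj, Ne, Subtype.coe_inj, e.injective.eq_iff, not_and_not_right,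
      ← residue_sub_val, ← residue_sub_val]
    norm_cast
    rw [← cycleGraph_adj']
    exact ⟨fun h => h.2 h.1, fun h => ⟨h.ne, fun _ => h⟩⟩
  refine ⟨hn, fun i => ?_, fun i => ?_, ?_, fun i j h2 hj => ?_⟩
  · simp [residue]
  · rw [hadj]
    right
    rw [add_sub_cancel_left]
    exact Int.emod_eq_of_lt (by omega) (by omega)
  · obtain ⟨k, hk⟩ := hn
    omega
  · rw [hadj, ← Int.add_emod_right, Int.emod_eq_of_lt (by omega) (by omega),
      Int.emod_eq_of_lt (by omega) (by omega)]
    omega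

/-- Let `G` be a (banner, odd hole)-free graph.  Then (i) `G` is perfect, or
(ii) `α(G) ≤ 2` (i.e. `G` has no co-triangle), or (iii) every odd antihole `A` of `G` is
contained in a homogeneous set `H` of `G` such that `G[H]` is co-triangle-free. -/
theorem stmt_2 {V : Type*} [Fintype V] (G : SimpleGraph V)
    (hbf : BannerFree G) (hohf : OddHoleFree G) :
    IsPerfect G ∨
    (¬ ∃ t : Finset V, Gᶜ.IsNClique 3 t) ∨
    (∀ A : Set V, IsOddAntihole G A → ∃ H : Set V, IsHomogeneous G H ∧ A ⊆ H ∧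
      ∀ t : Finset V, ↑t ⊆ H → ¬ Gᶜ.IsNClique 3 t) := by
  classical
  rw [or_iff_not_imp_left, or_iff_not_imp_left, not_not]
  rintro - ⟨t, ht⟩ A ⟨n, h5, hn, ⟨e⟩⟩
  have hP : PentagonFree Gᶜ := pentagonFree_compl (hohf 5 le_rfl (by decide))
  have : NeZero n := ⟨by omega⟩
  have h7 : 5 < n := by
    refine lt_of_le_of_ne h5 ?_
    rintro rfl
    exact hohf 5 le_rfl (by decide)
      ⟨pentagonEmbeddingCompl.trans (e.toEmbedding.trans (Embedding.induce A))⟩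
  have hc := isOddHoleWalk_compl h7 hn e
  obtain ⟨H, hAH, hmod, htri⟩ := hc.exists_module hbf.coBannerFree_compl hP
  have hclique : ∀ t : Finset V, ↑t ⊆ H → ¬ Gᶜ.IsNClique 3 t := by
    intro t htH ht
    obtain ⟨x, y, z, hxy, hxz, hyz, rfl⟩ := is3Clique_iff.mp ht
    exact htri x (htH (by simp)) y (htH (by simp)) z (htH (by simp)) hxy hyz hxz
  refine ⟨H, ⟨?_, ?_, fun v hv => ?_⟩, fun a ha => hAH ?_, hclique⟩
  · exact (Set.one_lt_ncard (Set.toFinite H)).mpr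
      ⟨_, hAH ⟨0, rfl⟩, _, hAH ⟨0 + 1, rfl⟩, (hc.adj 0).ne⟩
  · rintro rfl
    exact hclique t (Set.subset_univ _) ht
  · refine (hmod v hv).symm.imp (fun h w hw => ?_) (fun h w hw => ((compl_adj ..).mp (h w hw)).2)
    by_contra hvw
    exact h w hw ((compl_adj ..).mpr ⟨fun h => hv (h ▸ hw), hvw⟩)
  · obtain ⟨k, hk⟩ := e.surjective ⟨a, ha⟩
    exact ⟨(k : ℕ), by simp only [residue_of_lt, hk]⟩
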